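/- Let d ≥ 1 and δ > 0. Let Z be a measurable space, ℓ : ℝ^d × Z → ℝ a bounded measurable loss, and (Π_θ)_{θ∈ℝ^d} a family of probability measures on Z depending measurably on θ (a Markov kernel from ℝ^d to Z). Define the performative risk L(θ) := E_{Z∼Π_θ}[ℓ(θ; Z)] and assume L is continuous and bounded, and define L_δ(θ) := E_{w∼Unif(𝔹^d)}[L(θ + δ w)]. Then for every θ ∈ ℝ^d, E_{u∼Unif(𝕊^{d−1})}[ E_{Z∼Π_{θ+δu}}[ (d/δ) ℓ(θ + δ u; Z) u ] ] = ∇L_δ(θ); i.e., the one-point zero-th order gradient estimator g_δ(θ; u, Z) := (d/δ) ℓ(θ + δ u; Z) u with Z ∼ Π_{θ+δu} is an unbiased estimator of ∇L_δ(θ). -/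

import Mathlib

open MeasureTheory Metric ProbabilityTheory

/-- The uniform probability distribution on the closed unit ball of `ℝ^d`. -/
noncomputable def unifBall (d : ℕ) : Measure (EuclideanSpace ℝ (Fin d)) :=
  (volume (closedBall (0 : EuclideanSpace ℝ (Fin d)) 1))⁻¹ •
    volume.restrict (closedBall (0 : EuclideanSpace ℝ (Fin d)) 1)

/-- The uniform probability distribution on the unit sphere of `ℝ^d`. -/
noncomputable def unifSphere (d : ℕ) : Measure (sphere (0 : EuclideanSpace ℝ (Fin d)) 1) :=
  ((volume : Measure (EuclideanSpace ℝ (Fin d))).toSphere Set.univ)⁻¹ •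
    (volume : Measure (EuclideanSpace ℝ (Fin d))).toSphere

section SphericalIntegrals

open Module Filter Topology Set

variable {E : Type*} [NormedAddCommGroup E] [NormedSpace ℝ E] [FiniteDimensional ℝ E]
  [MeasurableSpace E] [BorelSpace E] (μ : Measure E) [μ.IsAddHaarMeasure]
  {F : Type*} [NormedAddCommGroup F] [NormedSpace ℝ F]

/-- Integration in polar coordinates. -/
theorem integral_eq_integral_Ioi_integral_toSphere [Nontrivial E] {g : E → F}
    (hg : Integrable g μ) :
    ∫ x, g x ∂μ = ∫ r in Ioi (0 : ℝ), r ^ (finrank ℝ E - 1) •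
      ∫ u : sphere (0 : E) 1, g (r • (u : E)) ∂μ.toSphere := by
  have hmp := μ.measurePreserving_homeomorphUnitSphereProd
  have hemb := (homeomorphUnitSphereProd E).measurableEmbedding
  have hsub (z : ({0}ᶜ : Set E)) : g ((homeomorphUnitSphereProd E z).2.1 •
      ((homeomorphUnitSphereProd E z).1 : E)) = g z := by
    congr 1
    exact congrArg Subtype.val ((homeomorphUnitSphereProd E).symm_apply_apply z)
  have hint : Integrable (fun p : sphere (0 : E) 1 × Ioi (0 : ℝ) ↦ g (p.2.1 • (p.1 : E)))
      (μ.toSphere.prod (.volumeIoiPow (finrank ℝ E - 1))) := by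
    rw [← hmp.integrable_comp_emb hemb]
    simp only [Function.comp_def, hsub]
    exact (integrableOn_iff_comap_subtypeVal (measurableSet_singleton _).compl).1 hg.integrableOn
  calc
    ∫ x, g x ∂μ = ∫ x : ({0}ᶜ : Set E), g x ∂(μ.comap (↑)) := by
      rw [integral_subtype_comap (measurableSet_singleton _).compl g, restrict_compl_singleton]
    _ = ∫ p, g (p.2.1 • (p.1 : E)) ∂μ.toSphere.prod (.volumeIoiPow (finrank ℝ E - 1)) := by
      rw [← hmp.integral_comp hemb]
      simp only [hsub]
    _ = ∫ r : Ioi (0 : ℝ), ∫ u : sphere (0 : E) 1, g (r.1 • (u : E)) ∂μ.toSphere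
          ∂.volumeIoiPow (finrank ℝ E - 1) := integral_prod_symm _ hint
    _ = _ := by
      simp only [Measure.volumeIoiPow, ENNReal.ofReal]
      rw [integral_withDensity_eq_integral_smul,
        integral_subtype_comap measurableSet_Ioi fun a ↦ Real.toNNReal (a ^ (finrank ℝ E - 1)) •
          ∫ u : sphere (0 : E) 1, g (a • (u : E)) ∂μ.toSphere,
        setIntegral_congr_fun measurableSet_Ioi fun x hx ↦ ?_]
      · rw [NNReal.smul_def, Real.coe_toNNReal _ (pow_nonneg hx.out.le _)]
      · exact (measurable_subtype_coe.pow_const _).real_toNNReal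

end SphericalIntegrals

section BallIntegrals

open Module Filter Topology Set

theorem hasCompactSupport_comp_norm_sq {E F : Type*} [NormedAddCommGroup E]
    [InnerProductSpace ℝ E] [FiniteDimensional ℝ E] [Zero F] {χ : ℝ → F} {b : ℝ}
    (hb : ∀ s, b ≤ s → χ s = 0) : HasCompactSupport fun y : E ↦ χ (‖y‖ ^ 2) := by
  refine HasCompactSupport.intro (isCompact_closedBall (0 : E) (max b 1)) fun x hx ↦ hb _ ?_
  have hx : max b 1 < ‖x‖ := by simpa using hx
  nlinarith [le_max_left b 1, le_max_right b 1]

variable {E : Type*} [NormedAddCommGroup E] [InnerProductSpace ℝ E] [FiniteDimensional ℝ E]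
  [MeasurableSpace E] [BorelSpace E] (μ : Measure E) [μ.IsAddHaarMeasure]

theorem hasFDerivAt_integral_radial_mul {f : E → ℝ} (hf : Continuous f) {χ : ℝ → ℝ}
    (hχ : ContDiff ℝ 1 χ) {b : ℝ} (hb : ∀ s, b ≤ s → χ s = 0) (x : E) :
    HasFDerivAt (fun x ↦ ∫ y, χ (‖y‖ ^ 2) * f (x + y) ∂μ)
      (innerSL ℝ (∫ y, (-(2 * deriv χ (‖y‖ ^ 2)) * f (x + y)) • y ∂μ)) x := by
  have hsupp : HasCompactSupport fun y : E ↦ χ (‖y‖ ^ 2) := hasCompactSupport_comp_norm_sq hb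
  have hcd : ContDiff ℝ 1 fun y : E ↦ χ (‖y‖ ^ 2) := hχ.comp (contDiff_norm_sq ℝ)
  have hfd (y : E) : fderiv ℝ (fun y : E ↦ χ (‖y‖ ^ 2)) y
      = (2 * deriv χ (‖y‖ ^ 2)) • innerSL ℝ y := by
    have h1 : HasFDerivAt (fun y : E ↦ χ (‖y‖ ^ 2)) _ y :=
      (hχ.differentiable one_ne_zero (‖y‖ ^ 2)).hasDerivAt.comp_hasFDerivAt y
        (hasStrictFDerivAt_norm_sq y).hasFDerivAt
    rw [h1.fderiv]
    ext v
    simp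
    ring
  have hd' : ∀ s, b + 1 ≤ s → deriv χ s = 0 := fun s hs ↦ by
    have : χ =ᶠ[𝓝 s] fun _ ↦ 0 := by
      filter_upwards [lt_mem_nhds (show b < s by linarith)] with t ht using hb t ht.le
    simp [this.deriv_eq]
  have hcont : Continuous (deriv χ) := hχ.continuous_deriv le_rfl
  have hint : Integrable (fun y ↦ (-(2 * deriv χ (‖y‖ ^ 2)) * f (x + y)) • y) μ := by
    refine Continuous.integrable_of_hasCompactSupport (by fun_prop) ?_
    refine (hasCompactSupport_comp_norm_sq (E := E) hd').mono fun y hy ↦ ?_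
    contrapose! hy
    simp_all
  have key := hsupp.hasFDerivAt_convolution_left (ContinuousLinearMap.mul ℝ ℝ) hcd
    (hf.locallyIntegrable (μ := μ)) x
  have hfun : (fun x ↦ ∫ y, χ (‖y‖ ^ 2) * f (x + y) ∂μ) =
      convolution (fun y ↦ χ (‖y‖ ^ 2)) f (ContinuousLinearMap.mul ℝ ℝ) μ := by
    ext x
    rw [convolution_def, ← integral_neg_eq_self]
    simp [sub_eq_add_neg]
  rw [hfun]
  refine key.congr_fderiv ?_
  rw [convolution_def, ← integral_neg_eq_self, ← ContinuousLinearMap.integral_comp_comm _ hint]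
  congr 1
  ext y v
  simp [hfd]
  rw [innerSL_apply_apply]
  ring

/-- The unnormalized surface integral of `f` times the unit normal over the sphere of radius `r`
centered at `x`. -/
noncomputable def sphereFlux (f : E → ℝ) (r : ℝ) (x : E) : E :=
  r ^ (finrank ℝ E - 1) • ∫ u : sphere (0 : E) 1, f (x + r • (u : E)) • (u : E) ∂μ.toSphere

theorem continuous_sphereFlux {f : E → ℝ} (hf : Continuous f) :
    Continuous fun p : ℝ × E ↦ sphereFlux μ f p.1 p.2 := by
  unfold sphereFlux
  refine (continuous_fst.pow _).smul ?_
  have := continuous_parametric_integral_of_continuous (μ := μ.toSphere)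
    (f := fun (p : ℝ × E) (u : sphere (0 : E) 1) ↦ f (p.2 + p.1 • (u : E)) • (u : E))
    (by unfold Function.uncurry; fun_prop) isCompact_univ
  simpa using this

theorem integral_radial_mul_smul_eq_integral_sphereFlux [Nontrivial E] {f : E → ℝ}
    (hf : Continuous f) {k : ℝ → ℝ} (hk : Continuous k) {b : ℝ} (hb : ∀ s, b ≤ s → k s = 0)
    (x : E) :
    ∫ y, (k (‖y‖ ^ 2) * f (x + y)) • y ∂μ =
      ∫ r in Ioi (0 : ℝ), (r * k (r ^ 2)) • sphereFlux μ f r x := by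
  have hint : Integrable (fun y ↦ (k (‖y‖ ^ 2) * f (x + y)) • y) μ := by
    refine Continuous.integrable_of_hasCompactSupport (by fun_prop) ?_
    refine (hasCompactSupport_comp_norm_sq (E := E) hb).mono fun y hy ↦ ?_
    contrapose! hy
    simp_all
  rw [integral_eq_integral_Ioi_integral_toSphere μ hint]
  refine setIntegral_congr_fun measurableSet_Ioi fun r hr ↦ ?_
  simp only [sphereFlux, norm_smul, norm_eq_of_mem_sphere, mul_one, Real.norm_eq_abs, sq_abs]
  rw [smul_comm (r * _), ← integral_smul (r * _)]
  refine congrArg _ (integral_congr_ae (.of_forall fun u ↦ ?_))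
  simp only [smul_smul]
  congr 1
  ring

theorem norm_integral_Ioi_deriv_smul_sub_le {F : Type*} [NormedAddCommGroup F] [NormedSpace ℝ F]
    [CompleteSpace F] {χ : ℝ → ℝ} (hχ : ContDiff ℝ 1 χ) (hanti : Antitone χ) {a b : ℝ}
    (ha : ∀ s ≤ a, χ s = 1) (ha0 : 0 ≤ a) (hb : ∀ s, b ≤ s → χ s = 0) {g : ℝ → F}
    (hg : Continuous g) {c : F} {η : ℝ}
    (hη : ∀ r, 0 ≤ r → a ≤ r ^ 2 → r ^ 2 ≤ b → ‖g r - c‖ ≤ η) :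
    ‖(∫ r in Ioi (0 : ℝ), (r * -(2 * deriv χ (r ^ 2))) • g r) - c‖ ≤ η := by
  set w : ℝ → ℝ := fun r ↦ r * -(2 * deriv χ (r ^ 2)) with hw
  have hcont : Continuous (deriv χ) := hχ.continuous_deriv le_rfl
  have hwc : Continuous w := by fun_prop
  have hlo : ∀ s < a, deriv χ s = 0 := fun s hs ↦ by
    have : χ =ᶠ[𝓝 s] fun _ ↦ 1 := by
      filter_upwards [gt_mem_nhds hs] with t ht using ha t ht.le
    simp [this.deriv_eq]
  have hhi : ∀ s, b < s → deriv χ s = 0 := fun s hs ↦ by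
    have : χ =ᶠ[𝓝 s] fun _ ↦ 0 := by
      filter_upwards [lt_mem_nhds hs] with t ht using hb t ht.le
    simp [this.deriv_eq]
  have hwsupp : HasCompactSupport w := by
    refine (hasCompactSupport_comp_norm_sq (E := ℝ) (χ := deriv χ) (b := b + 1)
      fun s hs ↦ hhi s (by linarith)).mono fun y hy ↦ ?_
    contrapose! hy
    simp_all
  have hwi : IntegrableOn w (Ioi 0) := (hwc.integrable_of_hasCompactSupport hwsupp).integrableOn
  have hχsq : HasCompactSupport fun r : ℝ ↦ χ (r ^ 2) := by
    simpa using hasCompactSupport_comp_norm_sq (E := ℝ) hb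
  have hderiv (r : ℝ) : deriv (fun r : ℝ ↦ χ (r ^ 2)) r = -w r := by
    have h1 : HasDerivAt (fun r : ℝ ↦ χ (r ^ 2)) _ r :=
      (hχ.differentiable one_ne_zero (r ^ 2)).hasDerivAt.comp r (hasDerivAt_pow 2 r)
    rw [h1.deriv, hw]
    push_cast
    ring
  have hw1 : ∫ r in Ioi (0 : ℝ), w r = 1 := by
    have h2 : ∫ r in Ioi (0 : ℝ), deriv (fun r : ℝ ↦ χ (r ^ 2)) r = -χ (0 ^ 2) :=
      hχsq.integral_Ioi_deriv_eq (hχ.comp (contDiff_id.pow 2)) 0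
    simp only [hderiv, integral_neg] at h2
    have h3 := ha 0 ha0
    simp only [ne_eq, OfNat.ofNat_ne_zero, not_false_eq_true, zero_pow, h3] at h2
    linarith
  have hwg : IntegrableOn (fun r ↦ w r • g r) (Ioi 0) :=
    ((hwc.smul hg).integrable_of_hasCompactSupport hwsupp.smul_right).integrableOn
  have hc : ∫ r in Ioi (0 : ℝ), w r • c = c := by rw [integral_smul_const, hw1, one_smul]
  rw [← hc, ← integral_sub hwg (hwi.smul_const c)]
  calc
    _ ≤ ∫ r in Ioi (0 : ℝ), w r * η := by
      refine norm_integral_le_of_norm_le (hwi.mul_const η) ?_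
      filter_upwards [ae_restrict_mem measurableSet_Ioi] with r hr
      have hr0 : (0 : ℝ) < r := hr
      have hw0 : 0 ≤ w r := mul_nonneg hr0.le (by linarith [hanti.deriv_nonpos (x := r ^ 2)])
      rw [← smul_sub, norm_smul, Real.norm_of_nonneg hw0]
      rcases lt_or_ge (r ^ 2) a with h | h
      · simp [hw, hlo _ h]
      rcases lt_or_ge b (r ^ 2) with h' | h'
      · simp [hw, hhi _ h']
      exact mul_le_mul_of_nonneg_left (hη r hr0.le h h') hw0
    _ = η := by rw [integral_mul_const, hw1, one_mul]

theorem tendsto_integral_smoothTransition_mul {f : E → ℝ} (hf : Continuous f) {R : ℝ}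
    (hR : 0 ≤ R) :
    Tendsto (fun ε : ℝ ↦ ∫ y, Real.smoothTransition (1 + (R ^ 2 - ‖y‖ ^ 2) / ε) * f y ∂μ)
      (𝓝[>] 0) (𝓝 (∫ y in closedBall (0 : E) R, f y ∂μ)) := by
  rw [← integral_indicator measurableSet_closedBall]
  refine tendsto_integral_filter_of_dominated_convergence
    ((closedBall (0 : E) (R + 1)).indicator fun y ↦ ‖f y‖) ?_ ?_ ?_ ?_
  · refine .of_forall fun ε ↦ Continuous.aestronglyMeasurable ?_
    have := Real.smoothTransition.continuous
    fun_prop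
  · filter_upwards [Ioo_mem_nhdsGT one_pos] with ε hε
    refine .of_forall fun y ↦ ?_
    by_cases hy : y ∈ closedBall (0 : E) (R + 1)
    · rw [indicator_of_mem hy, norm_mul, Real.norm_of_nonneg (Real.smoothTransition.nonneg _)]
      exact mul_le_of_le_one_left (norm_nonneg _) (Real.smoothTransition.le_one _)
    · rw [indicator_of_notMem hy, Real.smoothTransition.zero_of_nonpos, zero_mul, norm_zero]
      have hy : R + 1 < ‖y‖ := by simpa using hy
      have : (R ^ 2 - ‖y‖ ^ 2) / ε ≤ -1 := by
        rw [div_le_iff₀ hε.1]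
        nlinarith [hε.2]
      linarith
  · rw [integrable_indicator_iff measurableSet_closedBall]
    exact hf.norm.continuousOn.integrableOn_compact (isCompact_closedBall _ _)
  · refine .of_forall fun y ↦ tendsto_const_nhds.congr' ?_
    by_cases hy : y ∈ closedBall (0 : E) R
    · filter_upwards [self_mem_nhdsWithin] with ε hε
      have hε : 0 < ε := hε
      rw [indicator_of_mem hy, Real.smoothTransition.one_of_one_le, one_mul]
      have hy : ‖y‖ ≤ R := by simpa using hy
      have : 0 ≤ (R ^ 2 - ‖y‖ ^ 2) / ε := div_nonneg (by nlinarith [norm_nonneg y]) hε.le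
      linarith
    · have hyR : R < ‖y‖ := by simpa using hy
      filter_upwards [Ioo_mem_nhdsGT (show 0 < ‖y‖ ^ 2 - R ^ 2 by nlinarith)] with ε hε
      rw [indicator_of_notMem hy, Real.smoothTransition.zero_of_nonpos, zero_mul]
      have : (R ^ 2 - ‖y‖ ^ 2) / ε ≤ -1 := by
        rw [div_le_iff₀ hε.1]
        linarith [hε.2]
      linarith

/-- The gradient of the integral of a continuous function over a moving ball is the flux through
the bounding sphere. -/
theorem hasFDerivAt_integral_closedBall [Nontrivial E] {f : E → ℝ} (hf : Continuous f) {R : ℝ}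
    (hR : 0 < R) (x : E) :
    HasFDerivAt (fun x ↦ ∫ y in closedBall (0 : E) R, f (x + y) ∂μ)
      (innerSL ℝ (sphereFlux μ f R x)) x := by
  set χ : ℝ → ℝ → ℝ := fun ε s ↦ Real.smoothTransition (1 + (R ^ 2 - s) / ε)
  have hcd (ε : ℝ) : ContDiff ℝ 1 (χ ε) :=
    Real.smoothTransition.contDiff.comp (by fun_prop)
  have hanti {ε : ℝ} (hε : 0 < ε) : Antitone (χ ε) := fun s t hst ↦
    Real.smoothTransition.monotone (by gcongr)
  have hone {ε : ℝ} (hε : 0 < ε) (s : ℝ) (hs : s ≤ R ^ 2) : χ ε s = 1 :=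
    Real.smoothTransition.one_of_one_le (by linarith [div_nonneg (sub_nonneg.2 hs) hε.le])
  have hzero {ε : ℝ} (hε : 0 < ε) (s : ℝ) (hs : R ^ 2 + ε ≤ s) : χ ε s = 0 := by
    refine Real.smoothTransition.zero_of_nonpos ?_
    have : (R ^ 2 - s) / ε ≤ -1 := by
      rw [div_le_iff₀ hε]
      linarith
    linarith
  have hzero' {ε : ℝ} (hε : 0 < ε) (s : ℝ) (hs : R ^ 2 + ε + 1 ≤ s) :
      -(2 * deriv (χ ε) s) = 0 := by
    have : χ ε =ᶠ[𝓝 s] fun _ ↦ 0 := by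
      filter_upwards [lt_mem_nhds (show R ^ 2 + ε < s by linarith)] with t ht
        using hzero hε t ht.le
    simp [this.deriv_eq]
  have hpos : ∀ᶠ p : ℝ × E in 𝓝[>] 0 ×ˢ 𝓝 x, 0 < p.1 :=
    tendsto_fst.eventually (eventually_mem_nhdsWithin (a := (0 : ℝ)) (s := Ioi 0))
  refine hasFDerivAt_of_tendstoUniformlyOnFilter (l := 𝓝[>] (0 : ℝ))
    (f := fun ε x ↦ ∫ y, χ ε (‖y‖ ^ 2) * f (x + y) ∂μ)
    (f' := fun ε x ↦ innerSL ℝ (∫ y, (-(2 * deriv (χ ε) (‖y‖ ^ 2)) * f (x + y)) • y ∂μ))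
    (g' := fun x ↦ innerSL ℝ (sphereFlux μ f R x)) ?_ ?_ ?_
  · refine (innerSL ℝ (E := E)).uniformContinuous.comp_tendstoUniformlyOnFilter ?_
    rw [Metric.tendstoUniformlyOnFilter_iff]
    intro η hη
    have hcts := continuous_sphereFlux μ hf
    have hnear : ∀ᶠ p : ℝ × E in 𝓝 R ×ˢ 𝓝 x,
        dist (sphereFlux μ f p.1 p.2) (sphereFlux μ f R p.2) < η / 2 := by
      rw [← nhds_prod_eq]
      have hd : Continuous fun p : ℝ × E ↦
          dist (sphereFlux μ f p.1 p.2) (sphereFlux μ f R p.2) :=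
        hcts.dist (hcts.comp (by fun_prop : Continuous fun p : ℝ × E ↦ (R, p.2)))
      exact hd.continuousAt.eventually_lt_const (by simpa using half_pos hη)
    obtain ⟨p, hp, q, hq, hpq⟩ := eventually_prod_iff.1 hnear
    obtain ⟨ρ, hρ, hρp⟩ := Metric.eventually_nhds_iff.1 hp
    have hsmall : ∀ᶠ ε : ℝ in 𝓝[>] 0, ε ∈ Ioo 0 (ρ * R) := Ioo_mem_nhdsGT (mul_pos hρ hR)
    refine eventually_prod_iff.2 ⟨_, hsmall, q, hq, fun {ε} hε {z} hz ↦ ?_⟩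
    rw [dist_comm, dist_eq_norm, integral_radial_mul_smul_eq_integral_sphereFlux μ hf
      (k := fun s ↦ -(2 * deriv (χ ε) s))
      (((hcd ε).continuous_deriv le_rfl).const_mul 2).neg (hzero' hε.1)]
    refine (norm_integral_Ioi_deriv_smul_sub_le (hcd ε) (hanti hε.1) (hone hε.1) (sq_nonneg R)
      (hzero hε.1) (hcts.comp (by fun_prop : Continuous fun r : ℝ ↦ (r, z)))
      fun r hr0 h1 h2 ↦ ?_).trans_lt (half_lt_self hη)
    have hRr : R ≤ r := by nlinarith
    rw [← dist_eq_norm]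
    refine (hpq (hρp ?_) hz).le
    rw [Real.dist_eq, abs_of_nonneg (sub_nonneg.2 hRr)]
    nlinarith [hε.2]
  · filter_upwards [hpos] with p hp
    exact hasFDerivAt_integral_radial_mul μ hf (hcd p.1) (hzero hp) p.2
  · exact .of_forall fun y ↦
      tendsto_integral_smoothTransition_mul μ (hf.comp (continuous_const_add y)) hR.le

/-- The gradient of the integral of `w ↦ f (x + δ • w)` over the unit ball with respect to `x`. -/
theorem hasFDerivAt_integral_unit_closedBall_smul [Nontrivial E] {f : E → ℝ} (hf : Continuous f)
    {δ : ℝ} (hδ : 0 < δ) (x : E) :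
    HasFDerivAt (fun x ↦ ∫ w in closedBall (0 : E) 1, f (x + δ • w) ∂μ)
      (innerSL ℝ (δ⁻¹ • ∫ u : sphere (0 : E) 1, f (x + δ • (u : E)) • (u : E) ∂μ.toSphere)) x := by
  have h := (hasFDerivAt_integral_closedBall μ hf hδ x).const_smul (δ ^ finrank ℝ E)⁻¹
  have hfun : (fun x ↦ ∫ w in closedBall (0 : E) 1, f (x + δ • w) ∂μ) =
      (δ ^ finrank ℝ E)⁻¹ • fun x ↦ ∫ y in closedBall (0 : E) δ, f (x + y) ∂μ := by
    ext x
    rw [Measure.setIntegral_comp_smul_of_pos μ (fun y ↦ f (x + y)) _ hδ,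
      smul_unitClosedBall_of_nonneg hδ.le]
    rfl
  have hdim : (δ ^ finrank ℝ E)⁻¹ * δ ^ (finrank ℝ E - 1) = δ⁻¹ := by
    rw [← Nat.sub_add_cancel (finrank_pos (R := ℝ) (M := E)), pow_succ, Nat.add_sub_cancel]
    field_simp
  rw [hfun]
  refine h.congr_fderiv ?_
  rw [sphereFlux, ← map_smul, smul_smul, hdim]

end BallIntegrals

/-- the one-point zero-th order gradient estimator
`g_δ(θ; u, Z) = (d/δ) ℓ(θ + δu; Z) u`, with `u ∼ Unif(𝕊^{d-1})` and `Z ∼ Π_{θ+δu}`,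
is an unbiased estimator of `∇L_δ(θ)` where `L(θ) = E_{Z∼Π_θ}[ℓ(θ; Z)]` is the
performative risk and `L_δ` its ball-smoothed version. -/
theorem stmt2 (d : ℕ) (hd : 1 ≤ d) (δ : ℝ) (hδ : 0 < δ)
    {Z : Type*} [MeasurableSpace Z]
    (ℓ : EuclideanSpace ℝ (Fin d) → Z → ℝ)
    (hℓmeas : Measurable (Function.uncurry ℓ))
    (hℓbdd : ∃ G : ℝ, ∀ θ z, |ℓ θ z| ≤ G)
    (P : Kernel (EuclideanSpace ℝ (Fin d)) Z) [IsMarkovKernel P]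
    (hLcont : Continuous (fun θ : EuclideanSpace ℝ (Fin d) => ∫ z, ℓ θ z ∂(P θ)))
    (hLbdd : ∃ C : ℝ, ∀ θ, |∫ z, ℓ θ z ∂(P θ)| ≤ C) :
    ∀ θ : EuclideanSpace ℝ (Fin d),
      (∫ u : sphere (0 : EuclideanSpace ℝ (Fin d)) 1,
        (∫ z, ((d : ℝ) / δ) • (ℓ (θ + δ • (u : EuclideanSpace ℝ (Fin d))) z) •
            (u : EuclideanSpace ℝ (Fin d))
          ∂(P (θ + δ • (u : EuclideanSpace ℝ (Fin d)))))
        ∂(unifSphere d)) =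
      gradient
        (fun θ' : EuclideanSpace ℝ (Fin d) =>
          ∫ w, (∫ z, ℓ (θ' + δ • w) z ∂(P (θ' + δ • w))) ∂(unifBall d)) θ := by
  intro θ
  have : NeZero d := ⟨by omega⟩
  set L : EuclideanSpace ℝ (Fin d) → ℝ := fun θ ↦ ∫ z, ℓ θ z ∂(P θ)
  set V : ℝ := volume.real (ball (0 : EuclideanSpace ℝ (Fin d)) 1) with hV
  have hVc : volume.real (closedBall (0 : EuclideanSpace ℝ (Fin d)) 1) = V := by
    rw [hV, Measure.real, Measure.real, Measure.addHaar_closedBall_eq_addHaar_ball]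
  have hd0 : (d : ℝ) ≠ 0 := Nat.cast_ne_zero.2 (NeZero.ne d)
  have hderiv := (hasFDerivAt_integral_unit_closedBall_smul volume hLcont hδ θ).const_smul V⁻¹
  have hfun : (fun θ' ↦ ∫ w, (∫ z, ℓ (θ' + δ • w) z ∂(P (θ' + δ • w))) ∂(unifBall d)) =
      V⁻¹ • fun θ' ↦ ∫ w in closedBall (0 : EuclideanSpace ℝ (Fin d)) 1, L (θ' + δ • w) := by
    ext θ'
    rw [unifBall, integral_smul_measure, ENNReal.toReal_inv, ← Measure.real, hVc]
    rfl
  rw [← map_smul] at hderiv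
  rw [hfun, HasGradientAt.gradient (hasGradientAt_iff_hasFDerivAt.2 hderiv)]
  simp only [integral_smul, integral_smul_const]
  rw [unifSphere, integral_smul_measure, ENNReal.toReal_inv, ← Measure.real,
    Measure.toSphere_real_apply_univ, finrank_euclideanSpace_fin, smul_smul, smul_smul]
  rw [← hV]
  congr 1
  field_simp
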